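/- arXiv:2008.01056 — 3 statements merged into one kernel-verified Lean document; each statement's English description precedes it below -/
import Mathlib

section
/- For every forest (acyclic simple graph) G, we have adim(G) ≤ 6·(bdim(G))². -/
open SimpleGraph

/-- `f` is a resolving broadcast of `G`: for any two distinct vertices `x, y` there is a
vertex `z` with `f z > 0` such that `min (d(x,z)) (f z + 1) ≠ min (d(y,z)) (f z + 1)`,
where distances are extended naturals (`⊤` for vertices in different components). -/
def IsResolvingBroadcast {V : Type*} (G : SimpleGraph V) (f : V → ℕ) : Prop :=
  ∀ x y : V, x ≠ y → ∃ z : V, 0 < f z ∧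
    min (G.edist x z) ((f z : ℕ∞) + 1) ≠ min (G.edist y z) ((f z : ℕ∞) + 1)

/-- The broadcast dimension of `G`: the minimum of `∑ v, f v` over all
resolving broadcasts `f` of `G`. -/
noncomputable def bdim {V : Type*} [Fintype V] (G : SimpleGraph V) : ℕ :=
  sInf {n : ℕ | ∃ f : V → ℕ, IsResolvingBroadcast G f ∧ ∑ v, f v = n}

/-- `A` is an adjacency resolving set of `G`. -/
def IsAdjResolvingSet {V : Type*} (G : SimpleGraph V) (A : Set V) : Prop :=
  ∀ x y : V, x ≠ y → ∃ z ∈ A,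
    min (G.edist x z) 2 ≠ min (G.edist y z) 2

/-- The adjacency dimension of `G`: the minimum cardinality of an adjacency
resolving set of `G`. -/
noncomputable def adim {V : Type*} [Fintype V] (G : SimpleGraph V) : ℕ :=
  sInf {n : ℕ | ∃ A : Finset V, IsAdjResolvingSet G (A : Set V) ∧ A.card = n}

namespace SimpleGraph

variable {V : Type*} {G : SimpleGraph V} {m w x y z : V}

lemma Reachable.dist_le_dist_add_dist (hx : G.Reachable m x) (y : V) :
    G.dist x y ≤ G.dist m x + G.dist m y := by
  have h := hx.symm.dist_triangle_left y
  rwa [G.dist_comm (u := x) (v := m)] at h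

/-- In a forest, either `m` lies between `x` and `y`, or the paths from `m` to `x` and to `y`
leave `m` through the same neighbor. -/
lemma IsAcyclic.dist_add_dist_eq_or_exists_adj (hG : G.IsAcyclic)
    (hx : G.Reachable m x) (hy : G.Reachable m y) :
    G.dist x y = G.dist m x + G.dist m y ∨
      ∃ n, G.Adj m n ∧ G.dist n x + 1 = G.dist m x ∧ G.dist n y + 1 = G.dist m y := by
  obtain ⟨p, hp, hpl⟩ := hx.exists_path_of_dist
  obtain ⟨q, hq, hql⟩ := hy.exists_path_of_dist
  cases p with
  | nil => simp
  | @cons _ n _ h p =>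
  cases q with
  | nil => simp [dist_comm]
  | @cons _ n' _ h' q =>
  have aux {a b c : V} (hab : G.Adj a b) (r : G.Walk b c)
      (hr : (Walk.cons hab r).length = G.dist a c) : G.dist b c + 1 = G.dist a c := by
    have h1 := dist_le r
    have h2 := hab.reachable.dist_triangle_left c
    rw [dist_eq_one_iff_adj.mpr hab] at h2
    simp only [Walk.length_cons] at hr
    omega
  by_cases hn : n = n'
  · subst hn
    exact .inr ⟨n, h, aux h p hpl, aux h' q hql⟩
  · left
    have hpath : ((Walk.cons h p).reverse.append (Walk.cons h' q)).IsPath := by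
      rw [hG.isPath_iff_isChain, Walk.edges_append]
      refine ((hG.isPath_iff_isChain _).mp hp.reverse).append
        ((hG.isPath_iff_isChain _).mp hq) ?_
      simp only [Walk.edges_reverse, Walk.edges_cons, List.getLast?_reverse, List.head?_cons,
        Option.mem_some_iff, forall_eq']
      simpa [Sym2.eq_iff, h.ne', h'.ne'] using hn
    obtain ⟨r, hr, hrl⟩ := (hx.symm.trans hy).exists_path_of_dist
    have := congrArg Walk.length
      (Subtype.mk.inj ((hG.subsingleton_path x y).elim ⟨_, hpath⟩ ⟨r, hr⟩))
    simp only [Walk.length_append, Walk.length_reverse] at this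
    omega

lemma IsAcyclic.eq_of_adj_of_dist_add_one_eq (hG : G.IsAcyclic) {n n' : V}
    (hx : G.Reachable m x) (h : G.Adj m n) (h' : G.Adj m n')
    (hd : G.dist n x + 1 = G.dist m x) (hd' : G.dist n' x + 1 = G.dist m x) : n = n' := by
  obtain ⟨p, hp⟩ := (h.symm.reachable.trans hx).exists_walk_length_eq_dist
  obtain ⟨q, hq⟩ := (h'.symm.reachable.trans hx).exists_walk_length_eq_dist
  have h1 : (Walk.cons h p).IsPath := Walk.isPath_of_length_eq_dist _ (by simp [hp, hd])
  have h2 : (Walk.cons h' q).IsPath := Walk.isPath_of_length_eq_dist _ (by simp [hq, hd'])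
  have := Subtype.mk.inj ((hG.subsingleton_path m x).elim ⟨_, h1⟩ ⟨_, h2⟩)
  simp only [Walk.cons.injEq] at this
  exact this.1

/-- In a forest, a vertex between `x` and `y` separates every `w` from `x` or from `y`. -/
lemma IsAcyclic.dist_eq_or_dist_eq_of_between (hG : G.IsAcyclic)
    (hx : G.Reachable m x) (hy : G.Reachable m y) (hw : G.Reachable m w)
    (h : G.dist x y = G.dist m x + G.dist m y) :
    G.dist w x = G.dist m w + G.dist m x ∨ G.dist w y = G.dist m w + G.dist m y := by
  obtain h1 | ⟨n, hn, hnw, hnx⟩ := hG.dist_add_dist_eq_or_exists_adj hw hx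
  · exact .inl h1
  obtain h2 | ⟨n', hn', hnw', hny⟩ := hG.dist_add_dist_eq_or_exists_adj hw hy
  · exact .inr h2
  obtain rfl := hG.eq_of_adj_of_dist_add_one_eq hw hn hn' hnw hnw'
  have := (hn.symm.reachable.trans hx).dist_le_dist_add_dist y
  omega

lemma IsAcyclic.exists_median (hG : G.IsAcyclic)
    (hy : G.Reachable x y) (hz : G.Reachable x z) :
    ∃ m, G.Reachable x m ∧ G.dist x y = G.dist m x + G.dist m y ∧
      G.dist x z = G.dist m x + G.dist m z ∧ G.dist y z = G.dist m y + G.dist m z := by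
  obtain ⟨m, hm, hmin⟩ := WellFounded.has_min
    (measure fun m ↦ G.dist m x + G.dist m y + G.dist m z).wf {m | G.Reachable x m}
    ⟨x, Reachable.refl x⟩
  have hm : G.Reachable x m := hm
  have hmin (n : V) (hn : G.Adj m n) : G.dist m x + G.dist m y + G.dist m z ≤
      G.dist n x + G.dist n y + G.dist n z :=
    not_lt.mp (hmin n (hm.trans hn.reachable))
  have step {n : V} (hn : G.Adj m n) (u : V) : G.dist n u ≤ G.dist m u + 1 := by
    have := hn.symm.reachable.dist_triangle_left u
    rw [dist_eq_one_iff_adj.mpr hn.symm] at this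
    omega
  have key {a b : V} (ha : G.Reachable m a) (hb : G.Reachable m b)
      (H : ∀ n, G.Adj m n → G.dist n a + 1 = G.dist m a → G.dist n b + 1 = G.dist m b → False) :
      G.dist a b = G.dist m a + G.dist m b := by
    obtain h | ⟨n, hn, h1, h2⟩ := hG.dist_add_dist_eq_or_exists_adj ha hb
    · exact h
    · exact (H n hn h1 h2).elim
  have hx := hm.symm
  refine ⟨m, hm, key hx (hx.trans hy) ?_, key hx (hx.trans hz) ?_,
    key (hx.trans hy) (hx.trans hz) ?_⟩ <;>
  · intro n hn h1 h2
    have := hmin n hn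
    have := step hn x
    have := step hn y
    have := step hn z
    omega

/-- The four-point condition for the distance of a forest. -/
lemma IsAcyclic.dist_add_dist_le_max (hG : G.IsAcyclic)
    (hx : G.Reachable w x) (hy : G.Reachable w y) (hz : G.Reachable w z) :
    G.dist w x + G.dist y z ≤ max (G.dist w y + G.dist x z) (G.dist w z + G.dist x y) := by
  obtain ⟨m, hm, hxy, hxz, hyz⟩ := hG.exists_median (hx.symm.trans hy) (hx.symm.trans hz)
  have hmw : G.Reachable m w := (hx.trans hm).symm
  have h1 := hG.dist_eq_or_dist_eq_of_between (hmw.trans hx) (hmw.trans hy) hmw hxy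
  have h2 := hG.dist_eq_or_dist_eq_of_between (hmw.trans hx) (hmw.trans hz) hmw hxz
  have h3 := hG.dist_eq_or_dist_eq_of_between (hmw.trans hy) (hmw.trans hz) hmw hyz
  have h4 := hmw.dist_le_dist_add_dist x
  omega

/-- In a forest, let `z'` be a vertex maximizing the overlap of the paths from `z` to `z'` and
to `v`. Then the distances from `v` to `z` and `z'` determine the distance from `v` to `w`. -/
lemma IsAcyclic.dist_eq_of_overlap (hG : G.IsAcyclic) {z' v v' : V}
    (hz' : G.Reachable z z') (hw : G.Reachable z w)
    (hv : G.Reachable z v) (hv' : G.Reachable z v')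
    (hmax : G.dist z w + G.dist v z' ≤ G.dist z z' + G.dist v w)
    (hmax' : G.dist z w + G.dist v' z' ≤ G.dist z z' + G.dist v' w)
    (h : G.dist z v = G.dist z v') (h' : G.dist v z' = G.dist v' z') :
    G.dist v w = G.dist v' w := by
  have h1 := hG.dist_add_dist_le_max hv hz' hw
  have h2 := hG.dist_add_dist_le_max hv' hz' hw
  have h3 := hG.dist_add_dist_le_max hz' hv hw
  have h4 := hG.dist_add_dist_le_max hz' hv' hw
  rw [G.dist_comm (u := z') (v := v)] at h3
  rw [G.dist_comm (u := z') (v := v')] at h4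
  omega

end SimpleGraph

section Dominated

variable {V : Type*} {G : SimpleGraph V} {f : V → ℕ}

lemma isResolvingBroadcast_one (G : SimpleGraph V) : IsResolvingBroadcast G fun _ ↦ 1 := by
  intro x y hxy
  refine ⟨x, one_pos, fun h ↦ ?_⟩
  have : G.edist y x ≠ 0 := by simpa using hxy.symm
  simp [eq_comm (a := (0 : ℕ∞)), min_eq_iff, this] at h

open Classical in
/-- The vertices lying in some ball of the broadcast `f`. -/
noncomputable def dominated [Fintype V] (G : SimpleGraph V) (f : V → ℕ) : Finset V :=
  Finset.univ.filter fun v ↦ ∃ z, 0 < f z ∧ G.edist v z ≤ f z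

lemma not_mem_dominated_iff [Fintype V] {v : V} :
    v ∉ dominated G f ↔ ∀ z, 0 < f z → (f z : ℕ∞) + 1 ≤ G.edist v z := by
  simp [dominated, Order.add_one_le_iff_of_not_isMax]

lemma IsResolvingBroadcast.isAdjResolvingSet_dominated [Fintype V]
    (hf : IsResolvingBroadcast G f) : IsAdjResolvingSet G (dominated G f : Set V) := by
  intro x y hxy
  have hpos {a b : V} (hab : a ≠ b) : min (G.edist a b) 2 ≠ 0 := by
    simp [min_eq_iff, hab]
  by_cases hx : x ∈ dominated G f
  · exact ⟨x, hx, by simpa using (hpos hxy.symm).symm⟩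
  by_cases hy : y ∈ dominated G f
  · exact ⟨y, hy, by simpa using hpos hxy⟩
  rw [not_mem_dominated_iff] at hx hy
  obtain ⟨z, hz, hne⟩ := hf x y hxy
  exact (hne (by rw [min_eq_right (hx z hz), min_eq_right (hy z hz)])).elim

open Classical in
lemma IsResolvingBroadcast.card_dominated_le [Fintype V]
    (hf : IsResolvingBroadcast G f) (hG : G.IsAcyclic) :
    (dominated G f).card ≤ 6 * (∑ v, f v) ^ 2 := by
  have hball (v : V) : ∃ z, v ∈ dominated G f → 0 < f z ∧ G.edist v z ≤ f z ∧
      ∀ w, 0 < f w → G.edist v w ≤ f w → f z ≤ f w := by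
    by_cases hv : v ∈ dominated G f
    · obtain ⟨z, hz, hmin⟩ := Finset.exists_min_image
        (Finset.univ.filter fun z ↦ 0 < f z ∧ G.edist v z ≤ f z) f
        (by simpa [dominated, Finset.filter_nonempty_iff] using hv)
      simp only [Finset.mem_filter, Finset.mem_univ, true_and, and_imp] at hz hmin
      exact ⟨z, fun _ ↦ ⟨hz.1, hz.2, hmin⟩⟩
    · exact ⟨v, fun h ↦ (hv h).elim⟩
  choose c hc using hball
  let R (z : V) : Finset V := Finset.univ.filter fun w ↦ f z ≤ f w
  have hoverlap (v : V) : ∃ z', z' ∈ R (c v) ∧ G.Reachable (c v) z' ∧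
      ∀ w ∈ R (c v), G.Reachable (c v) w →
        G.dist (c v) w + G.dist v z' ≤ G.dist (c v) z' + G.dist v w := by
    obtain ⟨z', hz', hmax⟩ := Finset.exists_max_image
      ((R (c v)).filter fun w ↦ G.Reachable (c v) w)
      (fun w ↦ (G.dist (c v) w : ℤ) - G.dist v w)
      ⟨c v, by simp [R]⟩
    simp only [Finset.mem_filter] at hz' hmax
    refine ⟨z', hz'.1, hz'.2, fun w hw hw' ↦ ?_⟩
    have := hmax w ⟨hw, hw'⟩
    omega
  choose t ht htr hmax using hoverlap
  have hreach {v : V} (hv : v ∈ dominated G f) : G.Reachable (c v) v :=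
    (reachable_of_edist_ne_top
      (ne_top_of_le_ne_top (ENat.natCast_ne_top _) (hc v hv).2.1)).symm
  have hdist {v : V} (hv : v ∈ dominated G f) : G.dist (c v) v ≤ f (c v) := by
    have := (hc v hv).2.1
    rw [edist_comm, ← (hreach hv).coe_dist_eq_edist] at this
    exact_mod_cast this
  have hle : (dominated G f).card ≤ ((Finset.univ.filter fun z ↦ 0 < f z).sigma fun z ↦
      R z ×ˢ Finset.range (f z + 1) ×ˢ Finset.range (2 * f z + 1)).card := by
    refine Finset.card_le_card_of_injOn
      (fun v ↦ ⟨c v, t v, G.dist (c v) v, G.dist (c v) v + G.dist v (t v) - G.dist (c v) (t v)⟩)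
      ?_ ?_
    · intro v hv
      have hv : v ∈ dominated G f := hv
      have h1 := hdist hv
      have h2 := (hreach hv).dist_le_dist_add_dist (t v)
      simp only [Finset.coe_sigma, Set.mem_sigma_iff, Finset.mem_coe, Finset.mem_product,
        Finset.mem_range, Finset.mem_filter, Finset.mem_univ, true_and]
      exact ⟨(hc v hv).1, ht v, by omega, by omega⟩
    · intro v hv v' hv' heq
      have hv : v ∈ dominated G f := hv
      have hv' : v' ∈ dominated G f := hv'
      simp only [Sigma.mk.injEq] at heq
      obtain ⟨hcc, heq⟩ := heq
      simp only [heq_eq_eq, Prod.mk.injEq] at heq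
      obtain ⟨htt, hd, hd'⟩ := heq
      by_contra hne
      obtain ⟨w, hw, hne⟩ := hf v v' hne
      have hr := hreach hv
      have hr' := hreach hv'
      rw [← hcc] at hd hd' hr'
      have htr' := htr v
      rw [← htt] at hd'
      have hvt : G.dist v (t v) = G.dist v' (t v) := by
        have h1 := hr.dist_triangle_left (t v)
        have h2 := hr'.dist_triangle_left (t v)
        omega
      by_cases hwr : G.Reachable (c v) w
      · by_cases hwR : f (c v) ≤ f w
        · have h1 := hmax v w (by simpa [R] using hwR) hwr
          have h2 := hmax v' w (by simpa [R, ← hcc] using hwR) (hcc ▸ hwr)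
          rw [← hcc, ← htt] at h2
          have := hG.dist_eq_of_overlap htr' hwr hr hr' h1 h2 hd hvt
          rw [← (hr.symm.trans hwr).coe_dist_eq_edist, ← (hr'.symm.trans hwr).coe_dist_eq_edist,
            this] at hne
          exact hne rfl
        · have hfar {u : V} (hu : u ∈ dominated G f) (hcu : c v = c u) :
              (f w : ℕ∞) + 1 ≤ G.edist u w := by
            refine Order.add_one_le_of_lt (lt_of_not_ge fun h ↦ hwR ?_)
            rw [hcu]
            exact (hc u hu).2.2 w hw h
          rw [min_eq_right (hfar hv rfl), min_eq_right (hfar hv' hcc)] at hne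
          exact hne rfl
      · rw [edist_eq_top_of_not_reachable fun h ↦ hwr (hr.trans h),
          edist_eq_top_of_not_reachable fun h ↦ hwr (hr'.trans h)] at hne
        exact hne rfl
  refine hle.trans ?_
  rw [Finset.card_sigma, sq, Finset.sum_mul, Finset.mul_sum]
  refine (Finset.sum_le_sum fun z hz ↦ ?_).trans
    (Finset.sum_le_sum_of_subset (Finset.filter_subset _ _))
  have hz : 0 < f z := by simpa using hz
  have hR : (R z).card * f z ≤ ∑ v, f v :=
    ((R z).card_nsmul_le_sum f (f z) fun w hw ↦ (Finset.mem_filter.mp hw).2).trans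
      (Finset.sum_le_sum_of_subset (Finset.filter_subset _ _))
  simp only [Finset.card_product, Finset.card_range]
  calc (R z).card * ((f z + 1) * (2 * f z + 1))
      ≤ (R z).card * ((2 * f z) * (3 * f z)) := by gcongr <;> omega
    _ = 6 * (f z * ((R z).card * f z)) := by ring
    _ ≤ _ := by gcongr

end Dominated

/-- For every forest (acyclic simple graph) `G`, we have `adim G ≤ 6 * (bdim G)^2`. -/
theorem adim_le_six_mul_bdim_sq {V : Type*} [Fintype V] (G : SimpleGraph V)
    (hG : G.IsAcyclic) :
    adim G ≤ 6 * (bdim G) ^ 2 := by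
  obtain ⟨f, hf, hsum⟩ :
      bdim G ∈ {n : ℕ | ∃ f : V → ℕ, IsResolvingBroadcast G f ∧ ∑ v, f v = n} :=
    Nat.sInf_mem ⟨_, fun _ ↦ 1, isResolvingBroadcast_one G, rfl⟩
  rw [← hsum]
  have hadim : adim G ≤ (dominated G f).card :=
    Nat.sInf_le ⟨_, hf.isAdjResolvingSet_dominated, rfl⟩
  exact hadim.trans (hf.card_dominated_le hG)
end

section
/- If T₂ is a tree and T₁ is a tree that is isomorphic to a subgraph of T₂, then adim(T₁) ≤ adim(T₂). -/
open SimpleGraph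

section Truncation

variable {V : Type*} {G : SimpleGraph V}

open scoped Classical in
lemma min_edist_two_eq_ite (x z : V) :
    min (G.edist x z) 2 = if x = z then 0 else if G.Adj x z then 1 else 2 := by
  split_ifs with h h'
  · simp [h]
  · rw [edist_eq_one_iff_adj.mpr h']
    exact min_eq_left one_le_two
  · refine min_eq_right (not_lt.mp fun hlt => ?_)
    have hle : G.edist x z ≤ 1 := Order.le_of_lt_add_one (by rwa [one_add_one_eq_two])
    rcases hle.lt_or_eq with h0 | h1
    · exact h (edist_eq_zero_iff.mp (Order.lt_one_iff.mp h0))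
    · exact h' (edist_eq_one_iff_adj.mp h1)

lemma min_edist_two_self_ne {x y : V} (h : x ≠ y) :
    min (G.edist x x) 2 ≠ min (G.edist y x) 2 := by
  classical
  rw [min_edist_two_eq_ite, min_edist_two_eq_ite, if_pos rfl, if_neg h.symm]
  split_ifs <;> simp

lemma isAdjResolvingSet_univ : IsAdjResolvingSet G Set.univ :=
  fun x _ h => ⟨x, Set.mem_univ x, min_edist_two_self_ne h⟩

end Truncation

lemma adim_le_card {V : Type*} [Fintype V] {G : SimpleGraph V} {A : Finset V}
    (h : IsAdjResolvingSet G (A : Set V)) : adim G ≤ A.card :=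
  Nat.sInf_le ⟨A, h, rfl⟩

lemma exists_isAdjResolvingSet_card_eq_adim {V : Type*} [Fintype V] (G : SimpleGraph V) :
    ∃ A : Finset V, IsAdjResolvingSet G (A : Set V) ∧ A.card = adim G :=
  Nat.sInf_mem (s := {n | ∃ A : Finset V, IsAdjResolvingSet G (A : Set V) ∧ A.card = n})
    ⟨_, Finset.univ, by simpa using isAdjResolvingSet_univ, rfl⟩

section Embedding

variable {V₁ V₂ : Type*} {T₁ : SimpleGraph V₁} {T₂ : SimpleGraph V₂}

/-- In an acyclic graph, any path between two vertices of an embedded connected graph stays in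
the image, and comes from a path of the embedded graph. -/
lemma exists_isPath_map_eq (h₁ : T₁.Connected) (h₂ : T₂.IsAcyclic) (f : T₁ →g T₂)
    (hf : Function.Injective f) {a b : V₁} {q : T₂.Walk (f a) (f b)} (hq : q.IsPath) :
    ∃ p : T₁.Walk a b, p.map f = q := by
  obtain ⟨p, hp⟩ := h₁.exists_isPath a b
  exact ⟨p, congrArg Subtype.val
    ((h₂.subsingleton_path _ _).elim ⟨p.map f, hp.map hf⟩ ⟨q, hq⟩)⟩

lemma adj_of_adj_map (h₁ : T₁.Connected) (h₂ : T₂.IsAcyclic) (f : T₁ →g T₂)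
    (hf : Function.Injective f) {a b : V₁} (h : T₂.Adj (f a) (f b)) : T₁.Adj a b := by
  obtain ⟨p, hp⟩ := exists_isPath_map_eq h₁ h₂ f hf (Walk.IsPath.of_adj h)
  refine Walk.adj_of_length_eq_one (p := p) ?_
  rw [← Walk.length_map f, hp]
  rfl

lemma eq_of_adj_of_notMem_range (h₁ : T₁.Connected) (h₂ : T₂.IsAcyclic) (f : T₁ →g T₂)
    (hf : Function.Injective f) {z : V₂} (hz : z ∉ Set.range f) {a b : V₁}
    (ha : T₂.Adj (f a) z) (hb : T₂.Adj (f b) z) : a = b := by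
  by_contra hab
  have hq : (Walk.cons ha hb.symm.toWalk).IsPath := by
    simp [Walk.cons_isPath_iff, ha.ne, hf.ne hab, hb.ne']
  obtain ⟨p, hp⟩ := exists_isPath_map_eq h₁ h₂ f hf hq
  have hmem : z ∈ (p.map f).support := by simp [hp]
  rw [Walk.support_map, List.mem_map] at hmem
  obtain ⟨c, -, hc⟩ := hmem
  exact hz ⟨c, hc⟩

/-- A retraction of `T₂` onto the image of `T₁` that sends each vertex outside the image having
a neighbour in the image to that neighbour. -/
lemma exists_retraction (h₁ : T₁.Connected) (h₂ : T₂.IsAcyclic) (f : T₁ →g T₂)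
    (hf : Function.Injective f) :
    ∃ r : V₂ → V₁, (∀ a, r (f a) = a) ∧
      ∀ z ∉ Set.range f, ∀ a, T₂.Adj (f a) z → r z = a := by
  have key : ∀ z : V₂, ∃ c : V₁, (∀ a, f a = z → c = a) ∧
      (z ∉ Set.range f → ∀ a, T₂.Adj (f a) z → c = a) := by
    intro z
    by_cases hz : z ∈ Set.range f
    · obtain ⟨c, rfl⟩ := hz
      exact ⟨c, fun a h => (hf h).symm, fun h => absurd ⟨c, rfl⟩ h⟩
    · by_cases hn : ∃ c, T₂.Adj (f c) z
      · obtain ⟨c, hc⟩ := hn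
        exact ⟨c, fun a h => absurd ⟨a, h⟩ hz,
          fun _ a ha => eq_of_adj_of_notMem_range h₁ h₂ f hf hz hc ha⟩
      · exact ⟨h₁.nonempty.some, fun a h => absurd ⟨a, h⟩ hz, fun _ a ha => absurd ⟨a, ha⟩ hn⟩
  choose r hr hr' using key
  exact ⟨r, fun a => hr _ a rfl, hr'⟩

lemma IsAdjResolvingSet.image_retraction {f : T₁ →g T₂} (hf : Function.Injective f)
    (hadj : ∀ {a b}, T₂.Adj (f a) (f b) → T₁.Adj a b) {r : V₂ → V₁} (hr : ∀ a, r (f a) = a)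
    (hr' : ∀ z ∉ Set.range f, ∀ a, T₂.Adj (f a) z → r z = a) {A : Set V₂}
    (hA : IsAdjResolvingSet T₂ A) : IsAdjResolvingSet T₁ (r '' A) := by
  classical
  intro x y hxy
  obtain ⟨z, hzA, hz⟩ := hA (f x) (f y) (hf.ne hxy)
  refine ⟨r z, ⟨z, hzA, rfl⟩, ?_⟩
  by_cases hzr : z ∈ Set.range f
  · obtain ⟨c, rfl⟩ := hzr
    have hiff : ∀ a b, T₂.Adj (f a) (f b) ↔ T₁.Adj a b := fun a b => ⟨hadj, f.map_adj⟩
    rw [hr]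
    simpa only [min_edist_two_eq_ite, hf.eq_iff, hiff] using hz
  · have hne : ∀ a, f a ≠ z := fun a h => hzr ⟨a, h⟩
    simp only [min_edist_two_eq_ite, hne, if_false] at hz
    by_cases hx : T₂.Adj (f x) z
    · rw [hr' z hzr x hx]
      exact min_edist_two_self_ne hxy
    · by_cases hy : T₂.Adj (f y) z
      · rw [hr' z hzr y hy]
        exact (min_edist_two_self_ne hxy.symm).symm
      · simp [hx, hy] at hz

end Embedding

/-- If `T₂` is a tree and `T₁` is a tree isomorphic to a subgraph of `T₂`,
then `adim T₁ ≤ adim T₂`. -/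
theorem adim_mono_of_tree_subgraph {V₁ V₂ : Type*} [Fintype V₁] [Fintype V₂]
    (T₁ : SimpleGraph V₁) (T₂ : SimpleGraph V₂)
    (h₁ : T₁.IsTree) (h₂ : T₂.IsTree)
    (φ : V₁ ↪ V₂) (hφ : ∀ a b : V₁, T₁.Adj a b → T₂.Adj (φ a) (φ b)) :
    adim T₁ ≤ adim T₂ := by
  classical
  let f : T₁ →g T₂ := ⟨φ, fun {a b} => hφ a b⟩
  have hf : Function.Injective f := φ.injective
  obtain ⟨r, hr, hr'⟩ := exists_retraction h₁.connected h₂.isAcyclic f hf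
  obtain ⟨A, hA, hcard⟩ := exists_isAdjResolvingSet_card_eq_adim T₂
  have hB : IsAdjResolvingSet T₁ (A.image r : Set V₁) := by
    rw [Finset.coe_image]
    exact hA.image_retraction hf (adj_of_adj_map h₁.connected h₂.isAcyclic f hf) hr hr'
  calc adim T₁ ≤ (A.image r).card := adim_le_card hB
    _ ≤ A.card := Finset.card_image_le
    _ = adim T₂ := hcard
end

section
/- If T₂ is a tree and T₁ is a tree that is isomorphic to a subgraph of T₂, then dim(T₁) ≤ dim(T₂), where dim denotes the metric dimension. -/
open SimpleGraph

/-- `S` is a resolving set of `G`: every pair of distinct vertices is distinguished by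
its distances (as extended naturals) to some vertex of `S`. -/
def IsResolvingSet {V : Type*} (G : SimpleGraph V) (S : Set V) : Prop :=
  ∀ x y : V, x ≠ y → ∃ z ∈ S, G.edist x z ≠ G.edist y z

/-- The metric dimension of `G`: the minimum cardinality of a resolving set of `G`. -/
noncomputable def metricDim {V : Type*} [Fintype V] (G : SimpleGraph V) : ℕ :=
  sInf {n : ℕ | ∃ S : Finset V, IsResolvingSet G (S : Set V) ∧ S.card = n}

theorem SimpleGraph.Walk.IsPath.append_of_support_inter {V : Type*} {G : SimpleGraph V}
    {u v w : V} {p : G.Walk u v} {q : G.Walk v w} (hp : p.IsPath) (hq : q.IsPath)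
    (h : ∀ x ∈ p.support, x ∈ q.support → x = v) : (p.append q).IsPath := by
  have hq' := hq.support_nodup
  rw [← q.cons_tail_support, List.nodup_cons] at hq'
  rw [Walk.isPath_def, Walk.support_append, List.nodup_append]
  refine ⟨hp.support_nodup, hq'.2, ?_⟩
  rintro x hx _ hy rfl
  exact hq'.1 (h x hx (List.mem_of_mem_tail hy) ▸ hy)

theorem SimpleGraph.IsAcyclic.length_eq_dist {V : Type*} {G : SimpleGraph V} (hG : G.IsAcyclic)
    {u v : V} {p : G.Walk u v} (hp : p.IsPath) : p.length = G.dist u v := by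
  obtain ⟨q, hq, hlen⟩ := p.reachable.exists_path_of_dist
  have hpq : p = q :=
    congrArg Subtype.val ((hG.subsingleton_path u v).elim ⟨p, hp⟩ ⟨q, hq⟩)
  rw [hpq, hlen]

/-- Every vertex `z` of a tree has a gate in an embedded connected graph: a vertex through which
all distances from that graph to `z` are realised. -/
theorem SimpleGraph.IsTree.exists_gate {V W : Type*} {H : SimpleGraph V} {G : SimpleGraph W}
    (hH : H.Connected) (hG : G.IsTree) (f : H →g G) (hf : Function.Injective f) (z : W) :
    ∃ a : V, ∀ x : V, G.dist (f x) z = H.dist x a + G.dist (f a) z := by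
  classical
  have := hH.nonempty
  let a := Function.argmin fun a : V ↦ G.dist (f a) z
  refine ⟨a, fun x ↦ ?_⟩
  obtain ⟨p, hp, hpl⟩ := hH.exists_path_of_dist x a
  obtain ⟨q, hq, hql⟩ := hG.connected.exists_path_of_dist (f a) z
  have hpath : ((p.map f).append q).IsPath := by
    refine (hp.map hf).append_of_support_inter hq fun y hy hyq ↦ ?_
    obtain ⟨b, -, rfl⟩ := by simpa using hy
    by_contra hne
    have hle : G.dist (f a) z ≤ G.dist (f b) z :=
      Function.argmin_le (fun a : V ↦ G.dist (f a) z) b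
    have hlt := Walk.length_dropUntil_lt_length hyq hne
    have hd := dist_le (q.dropUntil _ hyq)
    omega
  rw [← hG.isAcyclic.length_eq_dist hpath, Walk.length_append, Walk.length_map, hpl, hql]

theorem isResolvingSet_univ {V : Type*} (G : SimpleGraph V) : IsResolvingSet G Set.univ :=
  fun x y hxy ↦ ⟨x, Set.mem_univ x, by
    rw [edist_self]; exact (edist_pos_of_ne hxy.symm).ne⟩

theorem exists_isResolvingSet_card_eq_metricDim {V : Type*} [Fintype V] (G : SimpleGraph V) :
    ∃ S : Finset V, IsResolvingSet G (S : Set V) ∧ S.card = metricDim G :=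
  Nat.sInf_mem (s := {n | ∃ S : Finset V, IsResolvingSet G (S : Set V) ∧ S.card = n})
    ⟨_, Finset.univ, by simpa using isResolvingSet_univ G, rfl⟩

theorem IsResolvingSet.metricDim_le_card {V : Type*} [Fintype V] {G : SimpleGraph V}
    {S : Finset V} (hS : IsResolvingSet G (S : Set V)) : metricDim G ≤ S.card :=
  Nat.sInf_le ⟨S, hS, rfl⟩

/-- If `T₂` is a tree and `T₁` is a tree isomorphic to a subgraph of `T₂`,
then `dim T₁ ≤ dim T₂`. -/
theorem metricDim_mono_of_tree_subgraph {V₁ V₂ : Type*} [Fintype V₁] [Fintype V₂]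
    (T₁ : SimpleGraph V₁) (T₂ : SimpleGraph V₂)
    (h₁ : T₁.IsTree) (h₂ : T₂.IsTree)
    (φ : V₁ ↪ V₂) (hφ : ∀ a b : V₁, T₁.Adj a b → T₂.Adj (φ a) (φ b)) :
    metricDim T₁ ≤ metricDim T₂ := by
  classical
  choose g hg using h₂.exists_gate h₁.connected ⟨φ, fun {a b} ↦ hφ a b⟩ φ.injective
  obtain ⟨S, hS, hcard⟩ := exists_isResolvingSet_card_eq_metricDim T₂
  have hres : IsResolvingSet T₁ (S.image g : Set V₁) := by
    intro x y hxy
    obtain ⟨z, hz, hne⟩ := hS (φ x) (φ y) (φ.injective.ne hxy)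
    refine ⟨g z, by simpa using ⟨z, hz, rfl⟩, fun heq ↦ hne ?_⟩
    have hdist : T₁.dist x (g z) = T₁.dist y (g z) := congrArg ENat.toNat heq
    have hsum : T₂.dist (φ x) z = T₂.dist (φ y) z :=
      (hg z x).trans ((congrArg (· + _) hdist).trans (hg z y).symm)
    rw [← (h₂.connected (φ x) z).coe_dist_eq_edist, hsum,
      (h₂.connected (φ y) z).coe_dist_eq_edist]
  calc metricDim T₁ ≤ (S.image g).card := hres.metricDim_le_card
    _ ≤ S.card := Finset.card_image_le
    _ = metricDim T₂ := hcard
end
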